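/- Let H₁ and H₂ be closed subspaces of a real Hilbert space H with ρ₀ = ρ₀(H₁, H₂) < 1. Let Π, Π₁, Π₂ denote the orthogonal projections onto H₁ + H₂, H₁, H₂ respectively, and for h ∈ H write Πh = (Πh)₁ + (Πh)₂ with (Πh)₁ ∈ H₁ and (Πh)₂ ∈ H₂. Then for every k ≥ 0, ‖(Πh)₁ − (Π₁ − Σ_{j=1}^{k} (Π₁Π₂)^j (I − Π₁)) h‖ ≤ (ρ₀^{2k+1} / (1 − ρ₀²)) ‖h‖. -/

import Mathlib

open scoped RealInnerProductSpace

/-- The cosine of the minimal angle between two subspaces of a real inner product space. -/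
noncomputable def rho0 {H : Type*} [NormedAddCommGroup H] [InnerProductSpace ℝ H]
    (H₁ H₂ : Submodule ℝ H) : ℝ :=
  sSup {r : ℝ | ∃ h₁ ∈ H₁, ∃ h₂ ∈ H₂, h₁ ≠ 0 ∧ h₂ ≠ 0 ∧ r = ⟪h₁, h₂⟫ / (‖h₁‖ * ‖h₂‖)}

theorem inner_le_rho0_mul {H : Type*} [NormedAddCommGroup H] [InnerProductSpace ℝ H]
    {H₁ H₂ : Submodule ℝ H} {x y : H} (hx : x ∈ H₁) (hy : y ∈ H₂) :
    ⟪x, y⟫ ≤ rho0 H₁ H₂ * (‖x‖ * ‖y‖) := by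
  rcases eq_or_ne x 0 with rfl | hx0
  · simp
  rcases eq_or_ne y 0 with rfl | hy0
  · simp
  rw [← div_le_iff₀ (by positivity)]
  refine le_csSup ⟨1, ?_⟩ ⟨x, hx, y, hy, hx0, hy0, rfl⟩
  rintro r ⟨a, -, b, -, -, -, rfl⟩
  exact div_le_one_of_le₀ (real_inner_le_norm a b) (by positivity)

theorem rho0_nonneg {H : Type*} [NormedAddCommGroup H] [InnerProductSpace ℝ H]
    (H₁ H₂ : Submodule ℝ H) : 0 ≤ rho0 H₁ H₂ := by
  by_cases h : ∃ x ∈ H₁, ∃ y ∈ H₂, x ≠ 0 ∧ y ≠ 0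
  · obtain ⟨x, hx, y, hy, hx0, hy0⟩ := h
    have h1 := inner_le_rho0_mul hx hy
    have h2 := inner_le_rho0_mul hx (H₂.neg_mem hy)
    rw [inner_neg_right, norm_neg] at h2
    have h3 : 0 < ‖x‖ * ‖y‖ := by positivity
    exact nonneg_of_mul_nonneg_left (by linarith) h3
  · refine Real.sSup_nonneg ?_
    rintro r ⟨x, hx, y, hy, hx0, hy0, -⟩
    exact absurd ⟨x, hx, y, hy, hx0, hy0⟩ h

theorem rho0_comm {H : Type*} [NormedAddCommGroup H] [InnerProductSpace ℝ H]
    (H₁ H₂ : Submodule ℝ H) : rho0 H₁ H₂ = rho0 H₂ H₁ := by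
  unfold rho0
  congr 1
  ext r
  constructor <;>
  · rintro ⟨x, hx, y, hy, hx0, hy0, rfl⟩
    exact ⟨y, hy, x, hx, hy0, hx0, by rw [real_inner_comm, mul_comm]⟩

theorem norm_proj_le_rho0_mul {H : Type*} [NormedAddCommGroup H] [InnerProductSpace ℝ H]
    {H₁ H₂ : Submodule ℝ H} {x p : H} (hx : x ∈ H₁) (hp : p ∈ H₂) (hxp : x - p ∈ H₂ᗮ) :
    ‖p‖ ≤ rho0 H₁ H₂ * ‖x‖ := by
  have h1 := Submodule.inner_right_of_mem_orthogonal hp hxp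
  rw [inner_sub_right, real_inner_self_eq_norm_sq, real_inner_comm] at h1
  have h2 := inner_le_rho0_mul hx hp
  rcases (norm_nonneg p).eq_or_lt with h0 | h0
  · rw [← h0]
    exact mul_nonneg (rho0_nonneg _ _) (norm_nonneg _)
  · refine le_of_mul_le_mul_right ?_ h0
    linarith

theorem norm_sq_eq_add_of_sub_mem_orthogonal {H : Type*} [NormedAddCommGroup H]
    [InnerProductSpace ℝ H] {K : Submodule ℝ H} {x p : H} (hp : p ∈ K) (hxp : x - p ∈ Kᗮ) :
    ‖x‖ ^ 2 = ‖p‖ ^ 2 + ‖x - p‖ ^ 2 := by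
  have h1 := Submodule.inner_right_of_mem_orthogonal hp hxp
  have h2 := norm_add_sq_real p (x - p)
  rw [add_sub_cancel, h1] at h2
  linarith

theorem eq_of_sub_mem_orthogonal {H : Type*} [NormedAddCommGroup H]
    [InnerProductSpace ℝ H] {K : Submodule ℝ H} {x y p q : H} (hp : p ∈ K) (hxp : x - p ∈ Kᗮ)
    (hq : q ∈ K) (hyq : y - q ∈ Kᗮ) (hxy : x - y ∈ Kᗮ) : p = q := by
  have h1 : p - q ∈ Kᗮ := by
    have := Kᗮ.add_mem (Kᗮ.sub_mem hyq hxp) hxy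
    rwa [show y - q - (x - p) + (x - y) = p - q by abel] at this
  have h2 := Submodule.inner_right_of_mem_orthogonal (K.sub_mem hp hq) h1
  exact sub_eq_zero.mp (inner_self_eq_zero.mp h2)

/-- Quantitative backfitting bound: if `ρ₀ = ρ₀(H₁,H₂) < 1` and `Πh = g₁ + g₂` is the unique
decomposition of the projection of `h` onto `H₁ + H₂`, then for every `k ≥ 0`,
`‖g₁ - (Π₁ - Σ_{j=1}^k (Π₁Π₂)^j (I - Π₁)) h‖ ≤ ρ₀^{2k+1}/(1 - ρ₀²) ‖h‖`. -/
theorem stmt3 {H : Type*} [NormedAddCommGroup H] [InnerProductSpace ℝ H] [CompleteSpace H]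
    (H₁ H₂ : Submodule ℝ H) (hc₁ : IsClosed (H₁ : Set H)) (hc₂ : IsClosed (H₂ : Set H))
    (hρ : rho0 H₁ H₂ < 1)
    (P P₁ P₂ : H →L[ℝ] H)
    (hP : ∀ x : H, P x ∈ H₁ ⊔ H₂ ∧ x - P x ∈ (H₁ ⊔ H₂ : Submodule ℝ H)ᗮ)
    (hP₁ : ∀ x : H, P₁ x ∈ H₁ ∧ x - P₁ x ∈ H₁ᗮ)
    (hP₂ : ∀ x : H, P₂ x ∈ H₂ ∧ x - P₂ x ∈ H₂ᗮ)
    (h g₁ g₂ : H) (hg₁ : g₁ ∈ H₁) (hg₂ : g₂ ∈ H₂) (hdec : P h = g₁ + g₂) (k : ℕ) :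
    ‖g₁ - (P₁ h - ∑ j ∈ Finset.Icc 1 k, ((P₁ ∘L P₂) ^ j) (h - P₁ h))‖ ≤
      rho0 H₁ H₂ ^ (2 * k + 1) / (1 - rho0 H₁ H₂ ^ 2) * ‖h‖ := by
  have hP₁id : ∀ x ∈ H₁, P₁ x = x := fun x hx =>
    eq_of_sub_mem_orthogonal (hP₁ x).1 (hP₁ x).2 hx (y := x) (by simp) (by simp)
  have hP₂id : ∀ x ∈ H₂, P₂ x = x := fun x hx =>
    eq_of_sub_mem_orthogonal (hP₂ x).1 (hP₂ x).2 hx (y := x) (by simp) (by simp)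
  have hP₁h : P₁ h = g₁ + P₁ g₂ := by
    nth_rw 1 [← hP₁id g₁ hg₁]
    rw [← map_add, ← hdec]
    exact eq_of_sub_mem_orthogonal (hP₁ _).1 (hP₁ _).2 (hP₁ _).1 (hP₁ _).2
      (Submodule.orthogonal_le le_sup_left (hP h).2)
  have hP₂h : P₂ h = g₂ + P₂ g₁ := by
    nth_rw 1 [← hP₂id g₂ hg₂]
    rw [← map_add, add_comm, ← hdec]
    exact eq_of_sub_mem_orthogonal (hP₂ _).1 (hP₂ _).2 (hP₂ _).1 (hP₂ _).2
      (Submodule.orthogonal_le le_sup_right (hP h).2)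
  have hres : P₂ (h - P₁ h) = g₂ - P₂ (P₁ g₂) := by
    rw [map_sub, hP₂h, hP₁h, map_add]
    abel
  have hrem : ∀ n : ℕ, g₁ - (P₁ h - ∑ j ∈ Finset.Icc 1 n, ((P₁ ∘L P₂) ^ j) (h - P₁ h)) =
      -((P₁ ∘L P₂) ^ n) (P₁ g₂) := by
    intro n
    induction n with
    | zero => simp [hP₁h]
    | succ n ih =>
      have hstep : ((P₁ ∘L P₂) ^ (n + 1)) (h - P₁ h) =
          ((P₁ ∘L P₂) ^ n) (P₁ g₂) - ((P₁ ∘L P₂) ^ (n + 1)) (P₁ g₂) := by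
        rw [pow_succ, mul_apply_eq_comp, mul_apply_eq_comp, ← map_sub,
          ContinuousLinearMap.comp_apply, ContinuousLinearMap.comp_apply, hres, map_sub]
      rw [Finset.sum_Icc_succ_top (by omega), hstep]
      rw [← sub_eq_zero] at ih ⊢
      rw [← ih]
      abel
  set ρ := rho0 H₁ H₂ with hρdef
  have hρ0 : 0 ≤ ρ := rho0_nonneg _ _
  have hle₂ : ∀ x ∈ H₁, ‖P₂ x‖ ≤ ρ * ‖x‖ := fun x hx =>
    norm_proj_le_rho0_mul hx (hP₂ x).1 (hP₂ x).2
  have hle₁ : ∀ x ∈ H₂, ‖P₁ x‖ ≤ ρ * ‖x‖ := fun x hx => by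
    rw [hρdef, rho0_comm]
    exact norm_proj_le_rho0_mul hx (hP₁ x).1 (hP₁ x).2
  have hpow : ∀ n : ℕ, ((P₁ ∘L P₂) ^ n) (P₁ g₂) ∈ H₁ ∧
      ‖((P₁ ∘L P₂) ^ n) (P₁ g₂)‖ ≤ ρ ^ (2 * n + 1) * ‖g₂‖ := by
    intro n
    induction n with
    | zero => simpa using ⟨(hP₁ g₂).1, hle₁ g₂ hg₂⟩
    | succ n ih =>
      rw [pow_succ', mul_apply_eq_comp, ContinuousLinearMap.comp_apply]
      refine ⟨(hP₁ _).1, ?_⟩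
      calc _ ≤ ρ * (ρ * (ρ ^ (2 * n + 1) * ‖g₂‖)) := by
            refine (hle₁ _ (hP₂ _).1).trans ?_
            gcongr
            refine (hle₂ _ ih.1).trans ?_
            gcongr
            exact ih.2
        _ = _ := by ring
  have hg₂le : ‖g₂‖ * (1 - ρ ^ 2) ≤ ‖h‖ := by
    have h1 : ‖h - P₁ h‖ ≤ ‖h‖ := by
      refine (sq_le_sq₀ (norm_nonneg _) (norm_nonneg _)).mp ?_
      nlinarith [norm_sq_eq_add_of_sub_mem_orthogonal (hP₁ h).1 (hP₁ h).2]
    have h2 : ‖P₂ (h - P₁ h)‖ ≤ ‖h - P₁ h‖ := by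
      refine (sq_le_sq₀ (norm_nonneg _) (norm_nonneg _)).mp ?_
      nlinarith [norm_sq_eq_add_of_sub_mem_orthogonal (hP₂ (h - P₁ h)).1 (hP₂ (h - P₁ h)).2]
    have h3 : ‖P₂ (P₁ g₂)‖ ≤ ρ * (ρ * ‖g₂‖) := by
      refine (hle₂ _ (hP₁ _).1).trans ?_
      gcongr
      exact hle₁ g₂ hg₂
    have h4 := norm_sub_norm_le g₂ (P₂ (P₁ g₂))
    rw [← hres] at h4
    linarith
  have hpos : 0 < 1 - ρ ^ 2 := by nlinarith
  rw [hrem, norm_neg, div_mul_eq_mul_div, mul_div_assoc]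
  refine (hpow k).2.trans ?_
  gcongr
  rwa [le_div_iff₀ hpos]
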